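/- Non-intersecting property of boundary minimizers: suppose W(x,t) = B(x,t) is achieved along an h-curve γ joining (x,t) to (0,τ) with γ(θ) > 0 for τ < θ ≤ t. Then for any intermediate point (x̄, t̄) on γ with τ < t̄ < t, the restriction of γ to [τ, t̄] is the strict minimizer of the value problem at (x̄, t̄): J(γ|_{[τ,t̄]}, x̄, t̄) < J(γ̃, x̄, t̄) for every admissible curve γ̃ differing from γ on a set of positive measure in [τ, t̄]. Consequently minimizing curves from distinct points (x₁,t), (x₂,t), x₁ ≠ x₂, do not cross in the interior of Q. -/

import Mathlib

open Real Set Filter MeasureTheory intervalIntegral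

/-- Convex conjugate of `f`. -/
noncomputable def conjFn (f : ℝ → ℝ) (u : ℝ) : ℝ := ⨆ v : ℝ, (u * v - f v)

/-- Running cost of a curve `γ` on `[s,t]`. -/
noncomputable def runCost (f β ub : ℝ → ℝ) (lf : ℝ) (γ : ℝ → ℝ) (s t : ℝ) : ℝ :=
  ∫ θ in s..t,
    (if γ θ = 0 then -(f (max (ub θ) lf)) else conjFn f (deriv γ θ)) *
      Real.exp (-β θ)

/-- Value function `W(x,t)`. -/
noncomputable def Wval (f β ub u₀ : ℝ → ℝ) (lf x t : ℝ) : ℝ :=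
  sInf {c : ℝ | ∃ γ : ℝ → ℝ, ∃ K : NNReal,
    LipschitzOnWith K γ (Set.Icc 0 t) ∧ γ t = x ∧
    (∀ θ ∈ Set.Icc (0:ℝ) t, 0 ≤ γ θ) ∧
    c = runCost f β ub lf γ 0 t + ∫ y in (0:ℝ)..(γ 0), u₀ y}

/-- The integrand of `runCost`. -/
noncomputable def runDensity (f β ub : ℝ → ℝ) (lf : ℝ) (γ : ℝ → ℝ) (θ : ℝ) : ℝ :=
  (if γ θ = 0 then -(f (max (ub θ) lf)) else conjFn f (deriv γ θ)) * Real.exp (-β θ)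

section Conjugate

variable {f : ℝ → ℝ}

theorem exists_forall_mul_sub_le (hf : Continuous f)
    (hsuper : Tendsto (fun u => f u / |u|) (cocompact ℝ) atTop) (u : ℝ) :
    ∃ p, ∀ v, u * v - f v ≤ u * p - f p := by
  refine Continuous.exists_forall_ge' (by fun_prop) 0 ?_
  have h1 := hsuper.eventually_ge_atTop (|u| + |f 0|)
  have h2 : ∀ᶠ v : ℝ in cocompact ℝ, 1 ≤ |v| :=
    (tendsto_norm_cocompact_atTop (E := ℝ)).eventually_ge_atTop 1
  filter_upwards [h1, h2] with v hv1 hv2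
  rw [le_div_iff₀ (by linarith)] at hv1
  have h3 : u * v ≤ |u| * |v| := by rw [← abs_mul]; exact le_abs_self _
  have h4 : |f 0| ≤ |f 0| * |v| := le_mul_of_one_le_right (abs_nonneg _) hv2
  have h5 := le_abs_self (f 0)
  nlinarith

theorem deriv_eq_of_forall_mul_sub_le (hf : Differentiable ℝ f) {u p : ℝ}
    (h : ∀ v, u * v - f v ≤ u * p - f p) : deriv f p = u := by
  have hmax : IsLocalMax (fun v => u * v - f v) p := Eventually.of_forall h
  have hd : HasDerivAt (fun v => u * v - f v) (u * 1 - deriv f p) p :=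
    ((hasDerivAt_id p).const_mul u).sub (hf p).hasDerivAt
  have := hmax.hasDerivAt_eq_zero hd
  linarith

theorem mul_sub_le_conjFn (hf : Continuous f)
    (hsuper : Tendsto (fun u => f u / |u|) (cocompact ℝ) atTop) (u p : ℝ) :
    u * p - f p ≤ conjFn f u := by
  obtain ⟨q, hq⟩ := exists_forall_mul_sub_le hf hsuper u
  exact le_ciSup (f := fun v => u * v - f v) ⟨_, by rintro _ ⟨v, rfl⟩; exact hq v⟩ p

theorem deriv_eq_of_conjFn_le (hf : Differentiable ℝ f)
    (hsuper : Tendsto (fun u => f u / |u|) (cocompact ℝ) atTop) {u p : ℝ}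
    (h : conjFn f u ≤ u * p - f p) : deriv f p = u :=
  deriv_eq_of_forall_mul_sub_le hf fun v =>
    (mul_sub_le_conjFn hf.continuous hsuper u v).trans h

theorem conjFn_deriv (hf : Differentiable ℝ f) (hmono : StrictMono (deriv f))
    (hsuper : Tendsto (fun u => f u / |u|) (cocompact ℝ) atTop) (p : ℝ) :
    conjFn f (deriv f p) = deriv f p * p - f p := by
  obtain ⟨q, hq⟩ := exists_forall_mul_sub_le hf.continuous hsuper (deriv f p)
  have := hmono.injective (deriv_eq_of_forall_mul_sub_le hf hq)
  subst this
  exact le_antisymm (ciSup_le hq) (mul_sub_le_conjFn hf.continuous hsuper _ _)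

theorem continuous_conjFn (hf : Continuous f)
    (hsuper : Tendsto (fun u => f u / |u|) (cocompact ℝ) atTop) : Continuous (conjFn f) := by
  have hc : ConvexOn ℝ univ (conjFn f) := by
    refine ⟨convex_univ, fun x _ y _ a b ha hb hab => ciSup_le fun v => ?_⟩
    have h1 := mul_le_mul_of_nonneg_left (mul_sub_le_conjFn hf hsuper x v) ha
    have h2 := mul_le_mul_of_nonneg_left (mul_sub_le_conjFn hf hsuper y v) hb
    simp only [smul_eq_mul]
    have h3 : (a * x + b * y) * v - f v = a * (x * v - f v) + b * (y * v - f v) := by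
      linear_combination (f v) * hab
    linarith
  exact continuousOn_univ.1 (hc.continuousOn isOpen_univ)

theorem exists_forall_le_deriv (hf : Differentiable ℝ f) (hmono : StrictMono (deriv f))
    (hsuper : Tendsto (fun u => f u / |u|) (cocompact ℝ) atTop) (K : ℝ) :
    ∃ P, 0 ≤ P ∧ (∀ v, P ≤ v → K ≤ deriv f v) ∧ ∀ v, v ≤ -P → deriv f v ≤ -K := by
  obtain ⟨p, hp⟩ := exists_forall_mul_sub_le hf.continuous hsuper K
  obtain ⟨q, hq⟩ := exists_forall_mul_sub_le hf.continuous hsuper (-K)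
  have hp' := deriv_eq_of_forall_mul_sub_le hf hp
  have hq' := deriv_eq_of_forall_mul_sub_le hf hq
  refine ⟨max |p| |q|, le_max_of_le_left (abs_nonneg p), fun v hv => ?_, fun v hv => ?_⟩
  · rw [← hp']
    exact hmono.monotone ((le_abs_self p).trans ((le_max_left _ _).trans hv))
  · rw [← hq']
    refine hmono.monotone ?_
    have := neg_abs_le q
    have := le_max_right |p| |q|
    linarith

end Conjugate

section Curves

theorem LipschitzOnWith.piecewise_Icc {K L : NNReal} {g h : ℝ → ℝ} {a b c : ℝ}
    (hg : LipschitzOnWith K g (Icc a b)) (hh : LipschitzOnWith L h (Icc b c)) (hgh : g b = h b) :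
    LipschitzOnWith (max K L) (fun θ => if θ ≤ b then g θ else h θ) (Icc a c) := by
  have key : ∀ x ∈ Icc a c, ∀ y ∈ Icc a c, x ≤ y →
      |(if x ≤ b then g x else h x) - (if y ≤ b then g y else h y)| ≤
        (max K L : NNReal) * |x - y| := by
    intro x hx y hy hxy
    have hK : (K : ℝ) ≤ (max K L : NNReal) := by exact_mod_cast le_max_left K L
    have hL : (L : ℝ) ≤ (max K L : NNReal) := by exact_mod_cast le_max_right K L
    split_ifs with h1 h2 h2
    · exact (hg.dist_le_mul x ⟨hx.1, h1⟩ y ⟨hy.1, h2⟩).trans (by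
        rw [Real.dist_eq]; gcongr)
    · push Not at h2
      have e1 := hg.dist_le_mul x ⟨hx.1, h1⟩ b ⟨hx.1.trans h1, le_rfl⟩
      have e2 := hh.dist_le_mul b ⟨le_rfl, h2.le.trans hy.2⟩ y ⟨h2.le, hy.2⟩
      rw [Real.dist_eq, Real.dist_eq, abs_of_nonpos (by linarith : x - b ≤ 0)] at e1
      rw [Real.dist_eq, Real.dist_eq, abs_of_nonpos (by linarith : b - y ≤ 0)] at e2
      rw [abs_of_nonpos (by linarith : x - y ≤ 0)]
      have e3 := abs_sub_le (g x) (g b) (h y)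
      rw [hgh] at e1 e3
      nlinarith
    · linarith
    · push Not at h1 h2
      exact (hh.dist_le_mul x ⟨h1.le, hx.2⟩ y ⟨h2.le, hy.2⟩).trans (by
        rw [Real.dist_eq]; gcongr)
  refine LipschitzOnWith.of_dist_le_mul fun x hx y hy => ?_
  rcases le_total x y with hxy | hxy
  · exact key x hx y hy hxy
  · rw [dist_comm, dist_comm x]
    exact key y hy x hx hxy

theorem ae_uIoc_mem_Ioo {a b : ℝ} (hab : a ≤ b) : ∀ᵐ θ : ℝ, θ ∈ uIoc a b → θ ∈ Ioo a b := by
  filter_upwards [compl_mem_ae_iff.2 (measure_singleton b)] with θ hθ h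
  rw [uIoc_of_le hab] at h
  exact ⟨h.1, lt_of_le_of_ne h.2 hθ⟩

theorem deriv_eq_of_eqOn_Ioo {g h : ℝ → ℝ} {a b θ : ℝ} (hgh : EqOn g h (Ioo a b))
    (hθ : θ ∈ Ioo a b) : deriv g θ = deriv h θ :=
  (hgh.eventuallyEq_of_mem (isOpen_Ioo.mem_nhds hθ)).deriv_eq

theorem runDensity_eqOn {f β ub : ℝ → ℝ} {lf : ℝ} {g h : ℝ → ℝ} {a b : ℝ}
    (hgh : EqOn g h (Ioo a b)) :
    EqOn (runDensity f β ub lf g) (runDensity f β ub lf h) (Ioo a b) := by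
  intro θ hθ
  simp only [runDensity, hgh hθ, deriv_eq_of_eqOn_Ioo hgh hθ]

theorem runCost_congr {f β ub : ℝ → ℝ} {lf : ℝ} {g h : ℝ → ℝ} {a b : ℝ} (hab : a ≤ b)
    (hgh : EqOn g h (Ioo a b)) : runCost f β ub lf g a b = runCost f β ub lf h a b := by
  refine intervalIntegral.integral_congr_ae ?_
  filter_upwards [ae_uIoc_mem_Ioo hab] with θ hθ h
  exact runDensity_eqOn hgh (hθ h)

theorem intervalIntegrable_congr_Ioo {F G : ℝ → ℝ} {a b : ℝ} (hab : a ≤ b)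
    (h : EqOn F G (Ioo a b)) (hF : IntervalIntegrable F volume a b) :
    IntervalIntegrable G volume a b := by
  refine hF.congr_ae ?_
  refine (ae_restrict_iff' measurableSet_uIoc).2 ?_
  filter_upwards [ae_uIoc_mem_Ioo hab] with θ hθ h'
  exact h (hθ h')

theorem intervalIntegrable_runDensity {f β ub : ℝ → ℝ} {lf : ℝ} (hf : Continuous f)
    (hsuper : Tendsto (fun u => f u / |u|) (cocompact ℝ) atTop) (hβ : Continuous β)
    (hub : ∃ M, ∀ θ, |ub θ| ≤ M) (hubm : Measurable ub) {K : NNReal} {g : ℝ → ℝ} {a b : ℝ}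
    (hab : a ≤ b) (hg : LipschitzOnWith K g (Icc a b)) :
    IntervalIntegrable (runDensity f β ub lf g) volume a b := by
  obtain ⟨G, hG, hgG⟩ := hg.extend_real
  refine intervalIntegrable_congr_Ioo hab
    (runDensity_eqOn (hgG.symm.mono Ioo_subset_Icc_self)) ?_
  have hcf := continuous_conjFn hf hsuper
  obtain ⟨M, hM⟩ := hub
  obtain ⟨A, hA⟩ := (isCompact_Icc (a := lf) (b := |M| + |lf|)).exists_bound_of_continuousOn
    hf.continuousOn
  obtain ⟨B, hB⟩ := (isCompact_Icc (a := -(K : ℝ)) (b := K)).exists_bound_of_continuousOn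
    hcf.continuousOn
  have hE : Continuous fun θ => Real.exp (-β θ) := by fun_prop
  refine IntervalIntegrable.mul_continuousOn ?_ hE.continuousOn
  have hmeas : Measurable fun θ =>
      if G θ = 0 then -(f (max (ub θ) lf)) else conjFn f (deriv G θ) :=
    Measurable.ite (hG.continuous.measurable (measurableSet_singleton 0))
      (hf.measurable.comp (hubm.max measurable_const)).neg
      (hcf.measurable.comp (measurable_deriv G))
  refine (intervalIntegrable_const (c := max A B)).mono_fun hmeas.aestronglyMeasurable
    (Eventually.of_forall fun θ => ?_)
  rw [Real.norm_eq_abs (max A B)]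
  refine le_trans ?_ (le_abs_self _)
  dsimp only
  split_ifs with h
  · rw [norm_neg]
    refine (hA _ ⟨le_max_right _ _, max_le ?_ ?_⟩).trans (le_max_left _ _)
    · linarith [le_abs_self (ub θ), hM θ, le_abs_self M, abs_nonneg lf]
    · linarith [le_abs_self lf, abs_nonneg M]
  · refine (hB _ ?_).trans (le_max_right _ _)
    have := norm_deriv_le_of_lipschitz (x₀ := θ) hG
    rw [Real.norm_eq_abs] at this
    exact abs_le.1 this

theorem runCost_add {f β ub : ℝ → ℝ} {lf : ℝ} {g : ℝ → ℝ} {a b c : ℝ}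
    (hf : Continuous f)
    (hsuper : Tendsto (fun u => f u / |u|) (cocompact ℝ) atTop) (hβ : Continuous β)
    (hub : ∃ M, ∀ θ, |ub θ| ≤ M) (hubm : Measurable ub) {K : NNReal}
    (hab : a ≤ b) (hbc : b ≤ c) (hg : LipschitzOnWith K g (Icc a c)) :
    runCost f β ub lf g a b + runCost f β ub lf g b c = runCost f β ub lf g a c :=
  intervalIntegral.integral_add_adjacent_intervals
    (intervalIntegrable_runDensity hf hsuper hβ hub hubm hab
      (hg.mono (Icc_subset_Icc_right hbc)))
    (intervalIntegrable_runDensity hf hsuper hβ hub hubm hbc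
      (hg.mono (Icc_subset_Icc_left hab)))

theorem LipschitzOnWith.intervalIntegrable_deriv {K : NNReal} {g : ℝ → ℝ} {a b : ℝ}
    (hab : a ≤ b) (hg : LipschitzOnWith K g (Icc a b)) :
    IntervalIntegrable (deriv g) volume a b := by
  rw [← uIcc_of_le hab] at hg
  exact hg.absolutelyContinuousOnInterval.intervalIntegrable_deriv

theorem LipschitzOnWith.integral_deriv_eq_sub {K : NNReal} {g : ℝ → ℝ} {a b : ℝ}
    (hab : a ≤ b) (hg : LipschitzOnWith K g (Icc a b)) :
    ∫ θ in a..b, deriv g θ = g b - g a := by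
  rw [← uIcc_of_le hab] at hg
  exact hg.absolutelyContinuousOnInterval.integral_deriv_eq_sub

/-- Fenchel–Young inequality, weighted along a curve. -/
theorem mul_sub_le_conjFn_mul_exp {f : ℝ → ℝ} (hf : Continuous f)
    (hsuper : Tendsto (fun u => f u / |u|) (cocompact ℝ) atTop) (y v b : ℝ) :
    y * v - f (y * Real.exp b) * Real.exp (-b) ≤ conjFn f v * Real.exp (-b) := by
  have h := mul_le_mul_of_nonneg_right (mul_sub_le_conjFn hf hsuper v (y * Real.exp b))
    (Real.exp_pos (-b)).le
  have he : Real.exp b * Real.exp (-b) = 1 := by rw [← Real.exp_add]; simp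
  calc _ = (v * (y * Real.exp b) - f (y * Real.exp b)) * Real.exp (-b) := by
        linear_combination (- v * y) * he
    _ ≤ _ := h

theorem bddBelow_cost {f β ub u₀ : ℝ → ℝ} {lf : ℝ} (hf : Continuous f)
    (hsuper : Tendsto (fun u => f u / |u|) (cocompact ℝ) atTop) (hβ : Continuous β)
    (hub : ∃ M, ∀ θ, |ub θ| ≤ M) (hubm : Measurable ub)
    (hu₀ : ∃ M, ∀ y, |u₀ y| ≤ M) (x : ℝ) {t : ℝ} (ht : 0 ≤ t) :
    BddBelow {c : ℝ | ∃ γ : ℝ → ℝ, ∃ K : NNReal,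
      LipschitzOnWith K γ (Set.Icc 0 t) ∧ γ t = x ∧
      (∀ θ ∈ Set.Icc (0:ℝ) t, 0 ≤ γ θ) ∧
      c = runCost f β ub lf γ 0 t + ∫ y in (0:ℝ)..(γ 0), u₀ y} := by
  obtain ⟨M, hM⟩ := hu₀
  obtain ⟨N, hN⟩ := hub
  have hE : Continuous fun θ => Real.exp (-β θ) := by fun_prop
  have hF : Continuous fun θ => f (-M * Real.exp (β θ)) * Real.exp (-β θ) := by fun_prop
  obtain ⟨A, hA⟩ := (isCompact_Icc (a := lf) (b := |N| + |lf|)).exists_bound_of_continuousOn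
    hf.continuousOn
  obtain ⟨B, hB⟩ := (isCompact_Icc (a := 0) (b := t)).exists_bound_of_continuousOn
    hE.continuousOn
  obtain ⟨C, hC⟩ := (isCompact_Icc (a := 0) (b := t)).exists_bound_of_continuousOn
    hF.continuousOn
  refine ⟨-M * x - max (A * B) C * t, ?_⟩
  rintro c ⟨γ, K, hγ, hγt, hγ0, rfl⟩
  have hu : -M * γ 0 ≤ ∫ y in (0:ℝ)..(γ 0), u₀ y := by
    have h0 := hγ0 0 ⟨le_rfl, ht⟩
    have h := intervalIntegral.norm_integral_le_of_norm_le_const (a := 0) (b := γ 0)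
      (f := u₀) (C := M) fun y _ => hM y
    rw [sub_zero, abs_of_nonneg h0, Real.norm_eq_abs] at h
    linarith [neg_abs_le (∫ y in (0:ℝ)..(γ 0), u₀ y)]
  have hr : -M * (x - γ 0) - max (A * B) C * t ≤ runCost f β ub lf γ 0 t := by
    have hi := (hγ.intervalIntegrable_deriv ht).const_mul (-M)
    have hc : ∫ θ in (0:ℝ)..t, (-M * deriv γ θ - max (A * B) C) =
        -M * (x - γ 0) - max (A * B) C * t := by
      rw [intervalIntegral.integral_sub hi intervalIntegrable_const,
        intervalIntegral.integral_const_mul, hγ.integral_deriv_eq_sub ht, hγt]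
      simp [mul_comm]
    rw [← hc]
    refine intervalIntegral.integral_mono_on_of_le_Ioo ht (hi.sub intervalIntegrable_const)
      (intervalIntegrable_runDensity hf hsuper hβ ⟨N, hN⟩ hubm ht hγ) fun θ hθ => ?_
    have hθ' := Ioo_subset_Icc_self hθ
    split_ifs with h
    · have hmin : IsLocalMin γ θ := by
        filter_upwards [isOpen_Ioo.mem_nhds hθ] with s hs
        rw [h]
        exact hγ0 s (Ioo_subset_Icc_self hs)
      rw [hmin.deriv_eq_zero]
      have h1 : |f (max (ub θ) lf)| ≤ A := hA _ ⟨le_max_right _ _, max_le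
        (by linarith [le_abs_self (ub θ), hN θ, le_abs_self N, abs_nonneg lf])
        (by linarith [le_abs_self lf, abs_nonneg N])⟩
      have h2 := hB θ hθ'
      rw [Real.norm_eq_abs, abs_of_pos (Real.exp_pos _)] at h2
      have h3 : f (max (ub θ) lf) * Real.exp (-β θ) ≤ A * B :=
        mul_le_mul ((le_abs_self _).trans h1) h2 (Real.exp_pos _).le
          ((abs_nonneg _).trans h1)
      linarith [le_max_left (A * B) C]
    · have h1 := mul_sub_le_conjFn_mul_exp hf hsuper (-M) (deriv γ θ) (β θ)
      have h2 := (le_abs_self _).trans (hC θ hθ')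
      linarith [le_max_right (A * B) C]
  linarith

/-- On a positive curve, equality in the integrated Fenchel–Young inequality forces the curve to
have the slope prescribed by the Euler–Lagrange equation almost everywhere. -/
theorem eqOn_of_runCost_le {f β ub : ℝ → ℝ} {lf : ℝ} (hf : Differentiable ℝ f)
    (hsuper : Tendsto (fun u => f u / |u|) (cocompact ℝ) atTop) (hβ : Continuous β)
    (hub : ∃ M, ∀ θ, |ub θ| ≤ M) (hubm : Measurable ub) {K : NNReal} {g : ℝ → ℝ} {a b y : ℝ}
    (hab : a ≤ b) (hg : LipschitzOnWith K g (Icc a b)) (hpos : ∀ θ ∈ Icc a b, 0 < g θ)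
    (hle : runCost f β ub lf g a b ≤
      y * (g b - g a) - ∫ θ in a..b, f (y * Real.exp (β θ)) * Real.exp (-β θ)) :
    ∀ θ ∈ Icc a b, g θ = g a + ∫ s in a..θ, deriv f (y * Real.exp (β s)) := by
  have hfc := hf.continuous
  have hF : Continuous fun θ => f (y * Real.exp (β θ)) * Real.exp (-β θ) := by fun_prop
  have hi1 := (hg.intervalIntegrable_deriv hab).const_mul y
  have hi2 := hi1.sub (hF.intervalIntegrable a b)
  have hi3 := intervalIntegrable_runDensity (lf := lf) hfc hsuper hβ hub hubm hab hg
  have hdens : ∀ θ ∈ Icc a b,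
      runDensity f β ub lf g θ = conjFn f (deriv g θ) * Real.exp (-β θ) := fun θ hθ => by
    rw [runDensity, if_neg (hpos θ hθ).ne']
  have hnn : 0 ≤ᵐ[volume.restrict (Ioc a b)] fun θ => runDensity f β ub lf g θ -
      (y * deriv g θ - f (y * Real.exp (β θ)) * Real.exp (-β θ)) := by
    refine (ae_restrict_iff' measurableSet_Ioc).2 (Eventually.of_forall fun θ hθ => ?_)
    simp only [Pi.zero_apply, hdens θ (Ioc_subset_Icc_self hθ)]
    linarith [mul_sub_le_conjFn_mul_exp hfc hsuper y (deriv g θ) (β θ)]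
  have hint : ∫ θ in a..b, (runDensity f β ub lf g θ -
      (y * deriv g θ - f (y * Real.exp (β θ)) * Real.exp (-β θ))) = 0 := by
    refine le_antisymm ?_ (intervalIntegral.integral_nonneg_of_ae_restrict hab ?_)
    · rw [intervalIntegral.integral_sub hi3 hi2,
        intervalIntegral.integral_sub hi1 (hF.intervalIntegrable a b),
        intervalIntegral.integral_const_mul, hg.integral_deriv_eq_sub hab]
      have : runCost f β ub lf g a b = ∫ θ in a..b, runDensity f β ub lf g θ := rfl
      linarith
    · rwa [restrict_Ioc_eq_restrict_Icc] at hnn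
  have hae := (intervalIntegral.integral_eq_zero_iff_of_le_of_nonneg_ae hab hnn
    (hi3.sub hi2)).1 hint
  rw [EventuallyEq, ae_restrict_iff' measurableSet_Ioc] at hae
  intro θ hθ
  have hgθ := (hg.mono (Icc_subset_Icc_right hθ.2)).integral_deriv_eq_sub hθ.1
  have : ∫ s in a..θ, deriv f (y * Real.exp (β s)) = ∫ s in a..θ, deriv g s := by
    refine intervalIntegral.integral_congr_ae ?_
    filter_upwards [hae] with s hs hs'
    rw [uIoc_of_le hθ.1] at hs'
    have hsab : s ∈ Ioc a b := ⟨hs'.1, hs'.2.trans hθ.2⟩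
    have h := hs hsab
    rw [Pi.zero_apply, hdens s (Ioc_subset_Icc_self hsab)] at h
    refine deriv_eq_of_conjFn_le hf hsuper ?_
    have he : Real.exp (β s) * Real.exp (-β s) = 1 := by rw [← Real.exp_add]; simp
    refine le_of_mul_le_mul_right (le_of_eq ?_) (Real.exp_pos (-β s))
    linear_combination h - y * deriv g s * he
  rw [this, hgθ]
  ring

theorem hasDerivAt_const_add_integral {F : ℝ → ℝ} (hF : Continuous F) (c a θ : ℝ) :
    HasDerivAt (fun θ => c + ∫ s in a..θ, F s) (F θ) θ :=
  (intervalIntegral.integral_hasDerivAt_right (hF.intervalIntegrable _ _)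
    (hF.stronglyMeasurableAtFilter _ _) hF.continuousAt).const_add c

/-- Equality case of the integrated Fenchel–Young inequality for extremal curves. -/
theorem runCost_extremal {f β ub : ℝ → ℝ} {lf : ℝ} (hf : Differentiable ℝ f)
    (hf' : Continuous (deriv f)) (hmono : StrictMono (deriv f))
    (hsuper : Tendsto (fun u => f u / |u|) (cocompact ℝ) atTop) (hβ : Continuous β)
    {g : ℝ → ℝ} {a b y : ℝ} (hab : a ≤ b)
    (hg : ∀ θ ∈ Icc a b, g θ = g a + ∫ s in a..θ, deriv f (y * Real.exp (β s)))
    (hpos : ∀ θ ∈ Icc a b, 0 < g θ) :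
    runCost f β ub lf g a b =
      y * (g b - g a) - ∫ θ in a..b, f (y * Real.exp (β θ)) * Real.exp (-β θ) := by
  have hfc := hf.continuous
  have hF : Continuous fun θ => f (y * Real.exp (β θ)) * Real.exp (-β θ) := by fun_prop
  have hD : Continuous fun θ => deriv f (y * Real.exp (β θ)) := by fun_prop
  have hD' : Continuous fun θ => y * deriv f (y * Real.exp (β θ)) := by fun_prop
  have e1 : y * (g b - g a) = ∫ θ in a..b, y * deriv f (y * Real.exp (β θ)) := by
    rw [intervalIntegral.integral_const_mul, hg b ⟨hab, le_rfl⟩]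
    ring
  rw [e1, ← intervalIntegral.integral_sub (hD'.intervalIntegrable _ _)
    (hF.intervalIntegrable _ _)]
  refine intervalIntegral.integral_congr_ae ?_
  filter_upwards [ae_uIoc_mem_Ioo hab] with θ hθ h
  have hθ' := hθ h
  rw [if_neg (hpos θ (Ioo_subset_Icc_self hθ')).ne',
    deriv_eq_of_eqOn_Ioo (fun s hs => hg s (Ioo_subset_Icc_self hs)) hθ',
    (hasDerivAt_const_add_integral hD (g a) a θ).deriv, conjFn_deriv hf hmono hsuper]
  have he : Real.exp (β θ) * Real.exp (-β θ) = 1 := by rw [← Real.exp_add]; simp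
  linear_combination (y * deriv f (y * Real.exp (β θ))) * he

/-- Two nearby points whose slope is bounded by `K` are joined by an extremal curve,
with a slope bound that does not depend on the points. -/
theorem exists_extremal_between {f β : ℝ → ℝ} (hf : Differentiable ℝ f)
    (hf' : Continuous (deriv f)) (hmono : StrictMono (deriv f))
    (hsuper : Tendsto (fun u => f u / |u|) (cocompact ℝ) atTop) (hβ : Continuous β)
    (K T₀ T : ℝ) :
    ∃ C, 0 ≤ C ∧ ∀ a b m, a ≤ b → Icc a b ⊆ Icc T₀ T → |m| ≤ K * (b - a) →
      ∃ y, (∫ s in a..b, deriv f (y * Real.exp (β s))) = m ∧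
        ∀ s ∈ Icc a b, |deriv f (y * Real.exp (β s))| ≤ C := by
  obtain ⟨P, hP0, hP, hP'⟩ := exists_forall_le_deriv hf hmono hsuper K
  have hE : Continuous fun θ => Real.exp (-β θ) := by fun_prop
  obtain ⟨B, hB⟩ := (isCompact_Icc (a := T₀) (b := T)).exists_bound_of_continuousOn
    hE.continuousOn
  have hΦ : Continuous fun p : ℝ × ℝ => deriv f (p.1 * Real.exp (β p.2)) := by fun_prop
  set Y := P * |B| with hY
  have hY0 : 0 ≤ Y := by positivity
  obtain ⟨C, hC⟩ := ((isCompact_Icc (a := -Y) (b := Y)).prod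
    (isCompact_Icc (a := T₀) (b := T))).exists_bound_of_continuousOn hΦ.continuousOn
  refine ⟨|C|, abs_nonneg _, fun a b m hab hsub hm => ?_⟩
  have hD : ∀ y, Continuous fun θ => deriv f (y * Real.exp (β θ)) := fun y => by fun_prop
  have hPY : ∀ s ∈ Icc a b, P ≤ Y * Real.exp (β s) := fun s hs => by
    have h := hB s (hsub hs)
    rw [Real.norm_eq_abs, abs_of_pos (Real.exp_pos _)] at h
    have he : Real.exp (-β s) * Real.exp (β s) = 1 := by rw [← Real.exp_add]; simp
    have h1 : Real.exp (-β s) ≤ |B| := h.trans (le_abs_self B)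
    calc P = P * (Real.exp (-β s) * Real.exp (β s)) := by rw [he, mul_one]
      _ ≤ P * (|B| * Real.exp (β s)) := by gcongr
      _ = _ := by rw [hY]; ring
  have hG : Continuous fun y => ∫ s in a..b, deriv f (y * Real.exp (β s)) :=
    intervalIntegral.continuous_parametric_intervalIntegral_of_continuous
      (μ := volume) (f := fun y s => deriv f (y * Real.exp (β s))) hΦ continuous_const
  have hup : m ≤ ∫ s in a..b, deriv f (Y * Real.exp (β s)) := by
    have h := intervalIntegral.integral_mono_on (μ := volume) hab
      (intervalIntegrable_const (c := K)) ((hD Y).intervalIntegrable a b)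
      fun s hs => hP _ (hPY s hs)
    rw [intervalIntegral.integral_const, smul_eq_mul] at h
    linarith [le_abs_self m]
  have hlow : (∫ s in a..b, deriv f (-Y * Real.exp (β s))) ≤ m := by
    have h := intervalIntegral.integral_mono_on (μ := volume) hab
      ((hD (-Y)).intervalIntegrable a b) (intervalIntegrable_const (c := -K))
      fun s hs => hP' _ (by linarith [hPY s hs])
    rw [intervalIntegral.integral_const, smul_eq_mul] at h
    linarith [neg_abs_le m]
  obtain ⟨y, hy, hym⟩ := intermediate_value_Icc (by linarith : -Y ≤ Y) hG.continuousOn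
    ⟨hlow, hup⟩
  exact ⟨y, hym, fun s hs => (hC (y, s) ⟨hy, hsub hs⟩).trans (le_abs_self C)⟩

theorem lipschitzOnWith_of_eq_integral {F g : ℝ → ℝ} (hF : Continuous F) {a b c : ℝ}
    (hg : ∀ θ ∈ Icc a b, g θ = c + ∫ s in a..θ, F s) :
    ∃ K : NNReal, LipschitzOnWith K g (Icc a b) := by
  obtain ⟨C, hC⟩ := (isCompact_Icc (a := a) (b := b)).exists_bound_of_continuousOn
    hF.continuousOn
  have h : LipschitzOnWith C.toNNReal (fun θ => c + ∫ s in a..θ, F s) (Icc a b) := by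
    refine (convex_Icc a b).lipschitzOnWith_of_nnnorm_hasDerivWithin_le
      (fun θ _ => (hasDerivAt_const_add_integral hF c a θ).hasDerivWithinAt) fun θ hθ => ?_
    rw [← NNReal.coe_le_coe, coe_nnnorm]
    exact (hC θ hθ).trans (Real.le_coe_toNNReal C)
  refine ⟨C.toNNReal, fun x hx y hy => ?_⟩
  rw [hg x hx, hg y hy]
  exact h hx hy

end Curves

/-- Non-intersecting property of boundary minimizers: if `W(x,t)` is achieved
by an `h`-curve `γ` from `(0,τ)` to `(x,t)` staying positive on `(τ,t]`, then
at every intermediate point `(x̄,t̄)` of `γ` the restriction of `γ` is the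
strict minimizer: any admissible competitor `γ̃` ending at `(x̄,t̄)` and
differing from `γ` on a set of positive measure in `[τ,t̄]` has strictly larger
cost. -/
theorem non_intersecting_property (f β ub u₀ : ℝ → ℝ) (lf : ℝ)
    (hf : ContDiff ℝ 2 f)
    (hconv : StrictConvexOn ℝ Set.univ f)
    (hsuper : Tendsto (fun u => f u / |u|) (cocompact ℝ) atTop)
    (hlf : deriv f lf = 0)
    (hβ : Continuous β)
    (hub : ∃ M, ∀ θ, |ub θ| ≤ M) (hubm : Measurable ub)
    (hu₀ : ∃ M, ∀ y, |u₀ y| ≤ M) (hu₀m : Measurable u₀)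
    (x t τ : ℝ) (hx : 0 < x) (hτ : 0 ≤ τ) (ht : τ < t)
    (γ : ℝ → ℝ) (y₀ : ℝ)
    (hγh : ∀ θ ∈ Set.Icc τ t, γ θ = ∫ s in τ..θ, deriv f (y₀ * Real.exp (β s)))
    (hγt : γ t = x)
    (hγpos : ∀ θ ∈ Set.Ioc τ t, 0 < γ θ)
    (hopt : Wval f β ub u₀ lf x t = runCost f β ub lf γ τ t + Wval f β ub u₀ lf 0 τ) :
    ∀ tbar ∈ Set.Ioo τ t, ∀ (γ' : ℝ → ℝ) (K : NNReal),
      LipschitzOnWith K γ' (Set.Icc 0 tbar) →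
      γ' tbar = γ tbar →
      (∀ θ ∈ Set.Icc (0:ℝ) tbar, 0 ≤ γ' θ) →
      0 < volume {θ ∈ Set.Icc τ tbar | γ' θ ≠ γ θ} →
      runCost f β ub lf γ τ tbar + Wval f β ub u₀ lf 0 τ <
        runCost f β ub lf γ' 0 tbar + ∫ y in (0:ℝ)..(γ' 0), u₀ y := by
  intro tbar htbar γ' K' hγ' hγ't hγ'0 hvol
  by_contra hcon
  push Not at hcon
  have hfd : Differentiable ℝ f := hf.differentiable (by norm_num)
  have hf' : Continuous (deriv f) := hf.continuous_deriv (by norm_num)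
  have hfc := hfd.continuous
  have hmono : StrictMono (deriv f) :=
    strictMonoOn_univ.1 (hconv.strictMonoOn_deriv fun v _ => hfd v)
  have hD : ∀ y, Continuous fun s => deriv f (y * Real.exp (β s)) := fun y => by fun_prop
  have ht0 : 0 ≤ t := hτ.trans ht.le
  obtain ⟨L, hγL⟩ := lipschitzOnWith_of_eq_integral (hD y₀) (g := γ) (c := 0)
    (fun θ hθ => (hγh θ hθ).trans (zero_add _).symm)
  have htbar' : tbar ∈ Icc τ t := Ioo_subset_Icc_self htbar
  -- the competitor followed by `γ`
  obtain ⟨g, hg⟩ : ∃ g : ℝ → ℝ, g = fun θ => if θ ≤ tbar then γ' θ else γ θ := ⟨_, rfl⟩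
  have hgL : LipschitzOnWith (max K' L) g (Icc 0 t) := by
    rw [hg]
    exact hγ'.piecewise_Icc (hγL.mono (Icc_subset_Icc_left htbar.1.le)) hγ't
  have hgl : ∀ θ ≤ tbar, g θ = γ' θ := fun θ h => by rw [hg]; exact if_pos h
  have hgr : ∀ θ, tbar ≤ θ → g θ = γ θ := fun θ h => by
    rcases h.eq_or_lt with rfl | h
    · rw [hgl _ le_rfl, hγ't]
    · rw [hg]; exact if_neg h.not_ge
  have hgt : g t = x := by rw [hgr t htbar.2.le, hγt]
  have hg0 : ∀ θ ∈ Icc (0:ℝ) t, 0 ≤ g θ := fun θ hθ => by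
    rcases le_total θ tbar with h | h
    · rw [hgl θ h]; exact hγ'0 θ ⟨hθ.1, h⟩
    · rw [hgr θ h]; exact (hγpos θ ⟨htbar.1.trans_le h, hθ.2⟩).le
  have htb0 : 0 ≤ tbar := hτ.trans htbar.1.le
  -- `g` is a minimizer at `(x, t)`
  have hgmin : runCost f β ub lf g 0 t + ∫ y in (0:ℝ)..(g 0), u₀ y ≤
      Wval f β ub u₀ lf x t := by
    have h1 := runCost_add (lf := lf) hfc hsuper hβ hub hubm htb0 htbar.2.le hgL
    have h2 := runCost_add (lf := lf) hfc hsuper hβ hub hubm htbar.1.le htbar.2.le hγL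
    have h3 : runCost f β ub lf g 0 tbar = runCost f β ub lf γ' 0 tbar :=
      runCost_congr htb0 fun θ hθ => hgl θ hθ.2.le
    have h4 : runCost f β ub lf g tbar t = runCost f β ub lf γ tbar t :=
      runCost_congr htbar.2.le fun θ hθ => hgr θ hθ.1.le
    rw [hgl 0 htb0]
    linarith
  have hWle : ∀ (ξ : ℝ → ℝ) (M : NNReal), LipschitzOnWith M ξ (Icc 0 t) → ξ t = x →
      (∀ θ ∈ Icc (0:ℝ) t, 0 ≤ ξ θ) →
      Wval f β ub u₀ lf x t ≤ runCost f β ub lf ξ 0 t + ∫ y in (0:ℝ)..(ξ 0), u₀ y :=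
    fun ξ M h1 h2 h3 => csInf_le (bddBelow_cost hfc hsuper hβ hub hubm hu₀ x ht0)
      ⟨ξ, M, h1, h2, h3, rfl⟩
  -- the last time at which the curves differ
  obtain ⟨σ, hσ, hσeq, hσr, hσl⟩ : ∃ σ ∈ Ioc τ tbar, g σ = γ σ ∧
      (∀ θ ∈ Icc σ t, g θ = γ θ) ∧ ∀ s < σ, ∃ θ ∈ Icc τ σ, s < θ ∧ g θ ≠ γ θ := by
    obtain ⟨s₁, hs₁, hs₁n⟩ := nonempty_of_measure_ne_zero hvol.ne'
    set S := {θ ∈ Icc τ tbar | γ' θ ≠ γ θ} with hS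
    have hbdd : BddAbove S := ⟨tbar, fun θ hθ => hθ.1.2⟩
    have hne : S.Nonempty := ⟨s₁, hs₁, hs₁n⟩
    have hle : sSup S ≤ tbar := csSup_le hne fun θ hθ => hθ.1.2
    have hge : s₁ ≤ sSup S := le_csSup hbdd ⟨hs₁, hs₁n⟩
    have hgt' : ∀ θ, sSup S < θ → θ ≤ t → g θ = γ θ := fun θ h h' => by
      rcases le_total θ tbar with hθ | hθ
      · rw [hgl θ hθ]
        by_contra hn
        exact h.not_ge (le_csSup hbdd ⟨⟨hs₁.1.trans (hge.trans h.le), hθ⟩, hn⟩)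
      · exact hgr θ hθ
    have hσt : sSup S < t := hle.trans_lt htbar.2
    have hcont : ContinuousOn (fun θ => g θ - γ θ) (Icc τ t) :=
      (hgL.continuousOn.mono (Icc_subset_Icc_left hτ)).sub hγL.continuousOn
    have hσeq : g (sSup S) = γ (sSup S) := by
      have hlim := (hcont (sSup S) ⟨hs₁.1.trans hge, hσt.le⟩).mono_left
        (nhdsWithin_mono (sSup S) (fun θ (hθ : θ ∈ Ioo (sSup S) t) =>
          ⟨hs₁.1.trans (hge.trans hθ.1.le), hθ.2.le⟩))
      have hzero : Tendsto (fun θ => g θ - γ θ) (nhdsWithin (sSup S) (Ioo (sSup S) t))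
          (nhds 0) := by
        refine tendsto_const_nhds.congr' ?_
        filter_upwards [self_mem_nhdsWithin] with θ hθ
        rw [hgt' θ hθ.1 hθ.2.le, sub_self]
      have : (nhdsWithin (sSup S) (Ioo (sSup S) t)).NeBot := by
        rw [nhdsWithin_Ioo_eq_nhdsGT hσt]; infer_instance
      exact sub_eq_zero.1 (tendsto_nhds_unique hlim hzero)
    have hsn : s₁ ≠ sSup S := fun h => by
      rw [← h, hgl s₁ hs₁.2] at hσeq
      exact hs₁n hσeq
    refine ⟨sSup S, ⟨hs₁.1.trans_lt (lt_of_le_of_ne hge hsn), hle⟩, hσeq, fun θ hθ => ?_,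
      fun s hs => ?_⟩
    · rcases hθ.1.eq_or_lt with rfl | h
      · exact hσeq
      · exact hgt' θ h hθ.2
    · obtain ⟨θ, hθ, hsθ⟩ := exists_lt_of_lt_csSup hne hs
      exact ⟨θ, ⟨hθ.1.1, le_csSup hbdd hθ⟩, hsθ, by rw [hgl θ hθ.1.2]; exact hθ.2⟩
  have hσt : σ < t := hσ.2.trans_lt htbar.2
  have hσ0 : 0 < σ := hτ.trans_lt hσ.1
  have he : 0 < γ σ := hγpos σ ⟨hσ.1, hσt.le⟩
  set M : NNReal := max K' L
  obtain ⟨C, hC0, hC⟩ := exists_extremal_between hfd hf' hmono hsuper hβ M 0 t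
  have hM0 : (0:ℝ) ≤ M := M.2
  obtain ⟨δ, hδ0, hδτ, hδt, hδ⟩ : ∃ δ > 0, δ < σ - τ ∧ δ < t - σ ∧
      (M + 2 * C) * δ < γ σ := by
    have hQ : 0 < M + 2 * C + 1 := by linarith
    refine ⟨min (min ((σ - τ) / 2) ((t - σ) / 2)) (γ σ / (M + 2 * C + 1)), ?_, ?_, ?_, ?_⟩
    · have := hσ.1
      exact lt_min (lt_min (by linarith) (by linarith)) (by positivity)
    · exact ((min_le_left _ _).trans (min_le_left _ _)).trans_lt (by linarith [hσ.1])
    · exact ((min_le_left _ _).trans (min_le_right _ _)).trans_lt (by linarith)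
    · refine (mul_le_mul_of_nonneg_left (min_le_right _ _) (by linarith)).trans_lt ?_
      rw [mul_div_assoc', div_lt_iff₀ hQ]
      linarith
  obtain ⟨a, ha⟩ : ∃ a, a = σ - δ := ⟨_, rfl⟩
  obtain ⟨b, hb⟩ : ∃ b, b = σ + δ := ⟨_, rfl⟩
  have hab : a ≤ b := by linarith
  have ha0 : 0 ≤ a := by linarith
  have hbt : b ≤ t := by linarith
  have hsub : Icc a b ⊆ Icc 0 t := Icc_subset_Icc ha0 hbt
  have hglow : ∀ θ ∈ Icc a b, γ σ - M * δ ≤ g θ := fun θ hθ => by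
    have h := hgL.dist_le_mul θ (hsub hθ) σ ⟨hσ0.le, hσt.le⟩
    rw [Real.dist_eq, Real.dist_eq, hσeq] at h
    have h1 : |θ - σ| ≤ δ := abs_le.2 ⟨by linarith [hθ.1], by linarith [hθ.2]⟩
    have h2 := mul_le_mul_of_nonneg_left h1 hM0
    linarith [neg_abs_le (g θ - γ σ)]
  have hCδ : 0 ≤ C * δ := by positivity
  have hgpos : ∀ θ ∈ Icc a b, 0 < g θ := fun θ hθ => by linarith [hglow θ hθ]
  obtain ⟨y, hy, hyC⟩ := hC a b (g b - g a) hab hsub (by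
    have h := hgL.dist_le_mul b (hsub ⟨hab, le_rfl⟩) a (hsub ⟨le_rfl, hab⟩)
    rwa [Real.dist_eq, Real.dist_eq, abs_of_nonneg (by linarith : 0 ≤ b - a)] at h)
  -- the extremal curve joining the two points of `g`
  obtain ⟨η, hη⟩ : ∃ η : ℝ → ℝ, ∀ θ, η θ = g a + ∫ s in a..θ, deriv f (y * Real.exp (β s)) :=
    ⟨_, fun _ => rfl⟩
  have hηa : η a = g a := by rw [hη, intervalIntegral.integral_same, add_zero]
  have hηb : η b = g b := by rw [hη, hy]; ring
  have hηpos : ∀ θ ∈ Icc a b, 0 < η θ := fun θ hθ => by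
    have h := intervalIntegral.norm_integral_le_of_norm_le_const (a := a) (b := θ)
      (f := fun s => deriv f (y * Real.exp (β s))) (C := C) fun s hs => by
        rw [uIoc_of_le hθ.1] at hs
        exact hyC s ⟨hs.1.le, hs.2.trans hθ.2⟩
    rw [Real.norm_eq_abs, abs_of_nonneg (by linarith [hθ.1] : 0 ≤ θ - a)] at h
    have h1 : C * (θ - a) ≤ C * (2 * δ) :=
      mul_le_mul_of_nonneg_left (by linarith [hθ.2]) hC0
    rw [hη]
    linarith [hglow a ⟨le_rfl, hab⟩,
      neg_abs_le (∫ s in a..θ, deriv f (y * Real.exp (β s)))]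
  obtain ⟨N, hηN⟩ := lipschitzOnWith_of_eq_integral (hD y) (g := η) (a := a) (b := b)
    fun θ _ => hη θ
  -- `g` with its arc over `[a, b]` replaced by the extremal curve
  obtain ⟨ζ, hζ⟩ : ∃ ζ : ℝ → ℝ, ζ = fun θ => if θ ≤ b then η θ else g θ := ⟨_, rfl⟩
  have hζL : LipschitzOnWith (max N M) ζ (Icc a t) := by
    rw [hζ]
    exact hηN.piecewise_Icc (hgL.mono (Icc_subset_Icc_left (ha0.trans hab))) hηb
  have hζa : ζ a = g a := by rw [hζ]; exact (if_pos hab).trans hηa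
  obtain ⟨ξ, hξ⟩ : ∃ ξ : ℝ → ℝ, ξ = fun θ => if θ ≤ a then g θ else ζ θ := ⟨_, rfl⟩
  have hξL : LipschitzOnWith (max M (max N M)) ξ (Icc 0 t) := by
    rw [hξ]
    exact (hgL.mono (Icc_subset_Icc_right (hab.trans hbt))).piecewise_Icc hζL hζa.symm
  have hξ1 : ∀ θ ≤ a, ξ θ = g θ := fun θ h => by rw [hξ]; exact if_pos h
  have hξ2 : ∀ θ ∈ Ioc a b, ξ θ = η θ := fun θ h => by
    rw [hξ, hζ]; exact (if_neg h.1.not_ge).trans (if_pos h.2)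
  have hξ3 : ∀ θ, b < θ → ξ θ = g θ := fun θ h => by
    rw [hξ, hζ]; exact (if_neg (hab.trans_lt h).not_ge).trans (if_neg h.not_ge)
  have hξW := hWle ξ _ hξL (by rw [hξ3 t (by linarith), hgt]) fun θ hθ => by
    rcases le_or_gt θ a with h | h
    · rw [hξ1 θ h]; exact hg0 θ hθ
    · rcases le_or_gt θ b with h' | h'
      · rw [hξ2 θ ⟨h, h'⟩]; exact (hηpos θ ⟨h.le, h'⟩).le
      · rw [hξ3 θ h']; exact hg0 θ hθ
  have hcost : runCost f β ub lf g a b ≤ runCost f β ub lf η a b := by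
    have h1 := runCost_add (lf := lf) hfc hsuper hβ hub hubm ha0 (hab.trans hbt) hgL
    have h2 := runCost_add (lf := lf) hfc hsuper hβ hub hubm hab hbt
      (hgL.mono (Icc_subset_Icc_left ha0))
    have h3 := runCost_add (lf := lf) hfc hsuper hβ hub hubm ha0 (hab.trans hbt) hξL
    have h4 := runCost_add (lf := lf) hfc hsuper hβ hub hubm hab hbt
      (hξL.mono (Icc_subset_Icc_left ha0))
    have h5 : runCost f β ub lf ξ 0 a = runCost f β ub lf g 0 a :=
      runCost_congr ha0 fun θ hθ => hξ1 θ hθ.2.le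
    have h6 : runCost f β ub lf ξ a b = runCost f β ub lf η a b :=
      runCost_congr hab fun θ hθ => hξ2 θ (Ioo_subset_Ioc_self hθ)
    have h7 : runCost f β ub lf ξ b t = runCost f β ub lf g b t :=
      runCost_congr hbt fun θ hθ => hξ3 θ hθ.1
    rw [hξ1 0 ha0] at hξW
    linarith
  rw [runCost_extremal hfd hf' hmono hsuper hβ hab (y := y)
    (fun θ _ => by rw [hηa, hη]) hηpos, hηa, hηb] at hcost
  have hgη := eqOn_of_runCost_le hfd hsuper hβ hub hubm hab
    (hgL.mono hsub) hgpos hcost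
  -- the two extremal curves overlap on `[σ, b]`, so they have the same parameter
  have hyy : y = y₀ := by
    have hm : (σ + b) / 2 ∈ Ioo σ b := ⟨by linarith, by linarith⟩
    have h1 : EqOn (fun θ => g a + ∫ s in a..θ, deriv f (y * Real.exp (β s)))
        (fun θ => 0 + ∫ s in τ..θ, deriv f (y₀ * Real.exp (β s))) (Ioo σ b) := fun θ hθ => by
      have e1 := hgη θ ⟨by linarith [hθ.1], hθ.2.le⟩
      have e2 := hγh θ ⟨by linarith [hθ.1, hσ.1], by linarith [hθ.2]⟩
      have e3 := hσr θ ⟨hθ.1.le, by linarith [hθ.2]⟩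
      dsimp only
      linarith
    have h2 := deriv_eq_of_eqOn_Ioo h1 hm
    rw [(hasDerivAt_const_add_integral (hD y) _ _ _).deriv,
      (hasDerivAt_const_add_integral (hD y₀) _ _ _).deriv] at h2
    exact mul_right_cancel₀ (Real.exp_pos _).ne' (hmono.injective h2)
  subst hyy
  obtain ⟨θ, hθ, haθ, hne⟩ := hσl a (by linarith)
  refine hne ?_
  have e1 := hgη θ ⟨haθ.le, by linarith [hθ.2]⟩
  have e2 := hgη σ ⟨by linarith, by linarith⟩
  have e3 := hγh θ ⟨hθ.1, hθ.2.trans hσt.le⟩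
  have e4 := hγh σ ⟨hσ.1.le, hσt.le⟩
  have e5 := intervalIntegral.integral_add_adjacent_intervals (μ := volume)
    ((hD y).intervalIntegrable a θ) ((hD y).intervalIntegrable θ σ)
  have e6 := intervalIntegral.integral_add_adjacent_intervals (μ := volume)
    ((hD y).intervalIntegrable τ θ) ((hD y).intervalIntegrable θ σ)
  linarith
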